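/- arXiv:2001.11594 — 2 statements merged into one kernel-verified Lean document; each statement's English description precedes it below -/
import Mathlib

section
/- Let (Ω,ℱ,P) be a probability space, L ∈ (0,∞], and let a : [0,L]×Ω → ℝ be 𝓛([0,L])⊗ℱ-measurable such that for P-almost every ω the path t ↦ a(t,ω) is of bounded variation on [0,L]. Then there exists ã : [0,L]×Ω → ℝ, 𝓛([0,L])⊗ℱ-measurable, with ã = a λ⊗P-almost everywhere, such that: (1) every path t ↦ ã(t,ω) is left-continuous and of bounded variation on [0,L]; and (2) the processes ã₊ and ã₋ are 𝓛([0,L])⊗ℱ-measurable and every one of their paths is left-continuous and nondecreasing. -/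
open MeasureTheory Filter Set
open scoped Topology ENNReal

noncomputable section

/-- The interval `[0, L]` for `L ∈ (0, ∞]`; equals `[0, ∞)` when `L = ∞`. -/
def II (L : ℝ≥0∞) : Set ℝ := {t : ℝ | 0 ≤ t ∧ ENNReal.ofReal t ≤ L}

/-- The interval `[0, L)`. -/
def IIco (L : ℝ≥0∞) : Set ℝ := {t : ℝ | 0 ≤ t ∧ ENNReal.ofReal t < L}

/-- The interval `(0, L]`. -/
def IIoc (L : ℝ≥0∞) : Set ℝ := {t : ℝ | 0 < t ∧ ENNReal.ofReal t ≤ L}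

/-- The set of partition sums `∑_{j=1}^n f(v(t_j) - v(t_{j-1}))` over all finite partitions
`0 = t₀ < t₁ < ⋯ < t_n = t` (with `n ∈ ℕ₀`). -/
def partitionSums (f : ℝ → ℝ) (v : ℝ → ℝ) (t : ℝ) : Set ℝ :=
  { S : ℝ | ∃ (n : ℕ) (u : ℕ → ℝ), u 0 = 0 ∧ u n = t ∧ (∀ j, j < n → u j < u (j + 1)) ∧
      S = ∑ j ∈ Finset.range n, f (v (u (j + 1)) - v (u j)) }

/-- The positive variation `v₊(t)` (with `sup ∅ = 0`, via `Real.sSup`). -/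
def posVar (v : ℝ → ℝ) (t : ℝ) : ℝ := sSup (partitionSums (fun x => max x 0) v t)

/-- The negative variation `v₋(t)` (with `sup ∅ = 0`, via `Real.sSup`). -/
def negVar (v : ℝ → ℝ) (t : ℝ) : ℝ := sSup (partitionSums (fun x => max (-x) 0) v t)

/-- `v` is of bounded variation on `[0,L]`: `sup_{t ∈ [0,L]} (v₊(t) + v₋(t)) < ∞`. -/
def IsBV (L : ℝ≥0∞) (v : ℝ → ℝ) : Prop :=
  ∃ M : ℝ, ∀ t ∈ II L, ∀ Sp ∈ partitionSums (fun x => max x 0) v t,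
    ∀ Sn ∈ partitionSums (fun x => max (-x) 0) v t, Sp + Sn ≤ M

/-- `v` is left-continuous at every point of `[0,L]`. -/
def LeftCts (L : ℝ≥0∞) (v : ℝ → ℝ) : Prop :=
  ∀ t ∈ II L, 0 < t → Tendsto v (𝓝[<] t) (𝓝 (v t))

/-- The Lebesgue σ-algebra on `ℝ` (the completion of the Borel σ-algebra w.r.t. Lebesgue
measure, i.e. the null-measurable sets of `volume`). -/
def lebSA : MeasurableSpace ℝ :=
  (inferInstance : MeasurableSpace (NullMeasurableSpace ℝ (volume : Measure ℝ)))

lemma aux_le {n : ℕ} {u : ℕ → ℝ} (h : ∀ j, j < n → u j < u (j + 1)) :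
    ∀ j, j ≤ n → u 0 ≤ u j := by
  intro j
  induction j with
  | zero => intro _; exact le_rfl
  | succ k ih => intro hk; exact (ih (by omega)).trans (h k (by omega)).le

lemma ps_nonneg_t {φ v : ℝ → ℝ} {t S : ℝ} (h : S ∈ partitionSums φ v t) : 0 ≤ t := by
  obtain ⟨n, u, h0, hn, hu, -⟩ := h
  rw [← h0, ← hn]; exact aux_le hu n le_rfl

lemma ps_neg {φ v : ℝ → ℝ} {t : ℝ} (h : t < 0) : partitionSums φ v t = ∅ := by
  ext S
  simp only [mem_empty_iff_false, iff_false]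
  intro hS
  exact absurd (ps_nonneg_t hS) (not_le.2 h)

lemma ps_zero_mem (φ v : ℝ → ℝ) : (0:ℝ) ∈ partitionSums φ v 0 :=
  ⟨0, fun _ => 0, rfl, rfl, by simp, by simp⟩

lemma ps_append {φ v : ℝ → ℝ} {s t S : ℝ} (h : S ∈ partitionSums φ v s) (hst : s < t) :
    S + φ (v t - v s) ∈ partitionSums φ v t := by
  obtain ⟨n, u, h0, hn, hu, rfl⟩ := h
  refine ⟨n + 1, fun j => if j ≤ n then u j else t, by simp [h0], by simp, ?_, ?_⟩
  · intro j hj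
    rcases Nat.lt_or_ge j n with h | h
    · have h1 : j ≤ n := h.le
      have h2 : j + 1 ≤ n := h
      simp only [h1, h2, if_true]; exact hu j h
    · have h1 : j = n := by omega
      subst h1
      simp [hn, hst]
  · rw [Finset.sum_range_succ]
    congr 1
    · apply Finset.sum_congr rfl
      intro j hj
      have hj := Finset.mem_range.1 hj
      have h1 : j ≤ n := hj.le
      have h2 : j + 1 ≤ n := hj
      simp only [h1, h2, if_true]
    · simp [hn]

lemma ps_last {φ v : ℝ → ℝ} {t S : ℝ} (h : S ∈ partitionSums φ v t) (ht : 0 < t) :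
    ∃ s S', s < t ∧ S' ∈ partitionSums φ v s ∧ S = S' + φ (v t - v s) := by
  obtain ⟨n, u, h0, hn, hu, rfl⟩ := h
  cases n with
  | zero => exact absurd (h0.symm.trans hn) ht.ne
  | succ m =>
    refine ⟨u m, ∑ j ∈ Finset.range m, φ (v (u (j + 1)) - v (u j)), ?_,
      ⟨m, u, h0, rfl, fun j hj => hu j (by omega), rfl⟩, ?_⟩
    · rw [← hn]; exact hu m (by omega)
    · rw [Finset.sum_range_succ, hn]

lemma ps_zero {φ v : ℝ → ℝ} : partitionSums φ v 0 = {0} := by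
  ext S
  simp only [mem_singleton_iff]
  constructor
  · rintro ⟨n, u, h0, hn, hu, rfl⟩
    cases n with
    | zero => simp
    | succ m =>
      have := aux_le hu m (by omega)
      have := hu m (by omega)
      linarith
  · rintro rfl; exact ps_zero_mem φ v

lemma ps_single {φ v : ℝ → ℝ} {t : ℝ} (ht : 0 < t) :
    φ (v t - v 0) ∈ partitionSums φ v t := by
  simpa using ps_append (ps_zero_mem φ v) ht

lemma ps_nonempty {φ v : ℝ → ℝ} {t : ℝ} (ht : 0 ≤ t) : (partitionSums φ v t).Nonempty := by
  rcases ht.eq_or_lt with rfl | ht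
  · exact ⟨0, ps_zero_mem φ v⟩
  · exact ⟨_, ps_single ht⟩

lemma ps_nonneg {φ v : ℝ → ℝ} (hφ : ∀ x, 0 ≤ φ x) {t S : ℝ} (h : S ∈ partitionSums φ v t) :
    0 ≤ S := by
  obtain ⟨n, u, h0, hn, hu, rfl⟩ := h
  exact Finset.sum_nonneg fun _ _ => hφ _

/-- increment estimate -/
lemma W_incr {φ v : ℝ → ℝ} {s t : ℝ} (hs : 0 ≤ s) (hst : s < t)
    (hb : BddAbove (partitionSums φ v t)) :
    sSup (partitionSums φ v s) + φ (v t - v s) ≤ sSup (partitionSums φ v t) := by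
  have : sSup (partitionSums φ v s) ≤ sSup (partitionSums φ v t) - φ (v t - v s) := by
    apply csSup_le (ps_nonempty hs)
    intro S hS
    have := le_csSup hb (ps_append hS hst)
    linarith
  linarith

lemma W_mono {φ v : ℝ → ℝ} (hφ : ∀ x, 0 ≤ φ x) {s t : ℝ} (hs : 0 ≤ s) (hst : s ≤ t)
    (hb : BddAbove (partitionSums φ v t)) :
    sSup (partitionSums φ v s) ≤ sSup (partitionSums φ v t) := by
  rcases hst.eq_or_lt with rfl | h
  · exact le_rfl
  · have := W_incr hs h hb
    have := hφ (v t - v s)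
    linarith

lemma W_left {φ v : ℝ → ℝ} (hφ : ∀ x, 0 ≤ φ x) (hc : Continuous φ)
    (hb : ∀ t, BddAbove (partitionSums φ v t))
    (hv : ∀ t, Tendsto v (𝓝[<] t) (𝓝 (v t))) (t : ℝ) :
    Tendsto (fun s => sSup (partitionSums φ v s)) (𝓝[<] t) (𝓝 (sSup (partitionSums φ v t))) := by
  rcases le_or_gt t 0 with ht | ht
  · have h1 : sSup (partitionSums φ v t) = 0 := by
      rcases ht.eq_or_lt with rfl | ht
      · simp [ps_zero]
      · simp [ps_neg ht]
    rw [h1]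
    apply tendsto_const_nhds.congr'
    filter_upwards [self_mem_nhdsWithin] with s hs
    rw [ps_neg (lt_of_lt_of_le hs ht)]; simp
  · rw [tendsto_order]
    constructor
    · intro c hcW
      obtain ⟨S, hS, hcS⟩ := exists_lt_of_lt_csSup (ps_nonempty ht.le) hcW
      obtain ⟨r, S', hrt, hS', rfl⟩ := ps_last hS ht
      have hT : Tendsto (fun s => S' + φ (v s - v r)) (𝓝[<] t) (𝓝 (S' + φ (v t - v r))) :=
        tendsto_const_nhds.add ((hc.tendsto _).comp ((hv t).sub tendsto_const_nhds))
      filter_upwards [hT.eventually (lt_mem_nhds hcS), Ioo_mem_nhdsLT hrt] with s h1 h2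
      exact h1.trans_le (le_csSup (hb s) (ps_append hS' h2.1))
    · intro c hcW
      filter_upwards [Ioo_mem_nhdsLT ht] with s hs
      exact (W_mono hφ hs.1.le hs.2.le (hb t)).trans_lt hcW

/-- grid approximation from the left -/
def dgrid (k : ℕ) (z : ℤ) : ℚ := ((z : ℚ) - 1) / (k + 1)

lemma dgrid_tendsto (t : ℝ) :
    Tendsto (fun k : ℕ => ((dgrid k ⌈((k : ℝ) + 1) * t⌉ : ℚ) : ℝ)) atTop (𝓝[<] t) := by
  have key : ∀ k : ℕ, ((dgrid k ⌈((k : ℝ) + 1) * t⌉ : ℚ) : ℝ) < t ∧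
      t - 1 / ((k : ℝ) + 1) ≤ ((dgrid k ⌈((k : ℝ) + 1) * t⌉ : ℚ) : ℝ) := by
    intro k
    have hk : (0:ℝ) < (k : ℝ) + 1 := by positivity
    have h1 := Int.ceil_lt_add_one (((k : ℝ) + 1) * t)
    have h2 := Int.le_ceil (((k : ℝ) + 1) * t)
    simp only [dgrid]
    push_cast
    constructor
    · rw [div_lt_iff₀ hk]; linarith
    · rw [le_div_iff₀ hk]
      have : (t - 1 / ((k : ℝ) + 1)) * ((k : ℝ) + 1) = ((k : ℝ) + 1) * t - 1 := by
        field_simp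
      linarith
  rw [tendsto_nhdsWithin_iff]
  refine ⟨?_, Eventually.of_forall fun k => (key k).1⟩
  refine tendsto_of_tendsto_of_tendsto_of_le_of_le (g := fun k : ℕ => t - 1 / ((k : ℝ) + 1))
    (h := fun _ => t) ?_ tendsto_const_nhds (fun k => (key k).2) (fun k => (key k).1.le)
  have := (tendsto_const_nhds (x := t)).sub (tendsto_one_div_add_atTop_nhds_zero_nat (𝕜 := ℝ))
  simpa using this

lemma joint_meas {Ω : Type*} [MeasurableSpace Ω] {g h : ℝ → Ω → ℝ}
    (hg : ∀ s, Measurable (g s))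
    (hgh : ∀ t ω, Tendsto (fun s => g s ω) (𝓝[<] t) (𝓝 (h t ω))) :
    Measurable fun p : ℝ × Ω => h p.1 p.2 := by
  refine measurable_of_tendsto_metrizable
    (f := fun k (p : ℝ × Ω) => g ((dgrid k ⌈((k : ℝ) + 1) * p.1⌉ : ℚ) : ℝ) p.2) ?_ ?_
  · intro k
    have h1 : Measurable fun q : ℤ × Ω => g ((dgrid k q.1 : ℚ) : ℝ) q.2 :=
      measurable_from_prod_countable_right fun z => hg ((dgrid k z : ℚ) : ℝ)
    have h2 : Measurable fun p : ℝ × Ω => ((⌈((k : ℝ) + 1) * p.1⌉ : ℤ), p.2) :=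
      (Int.measurable_ceil.comp (measurable_fst.const_mul _)).prodMk measurable_snd
    exact h1.comp h2
  · rw [tendsto_pi_nhds]
    intro p
    exact (hgh p.1 p.2).comp (dgrid_tendsto p.1)

/-- partition with interior points from a list -/
def luu (t : ℝ) (p : ℕ × List ℚ) (j : ℕ) : ℝ :=
  if j = 0 then 0 else if j < p.1 then ((p.2.getD j 0 : ℚ) : ℝ) else t

lemma W_meas {Ω : Type*} [MeasurableSpace Ω] {φ : ℝ → ℝ} (hc : Continuous φ)
    {b : ℝ → Ω → ℝ} (hbm : ∀ s, Measurable (b s))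
    (hl : ∀ ω t, Tendsto (fun s => b s ω) (𝓝[<] t) (𝓝 (b t ω)))
    (hb : ∀ ω t, BddAbove (partitionSums φ (fun s => b s ω) t)) (t : ℝ) :
    Measurable fun ω => sSup (partitionSums φ (fun s => b s ω) t) := by
  rcases lt_or_ge t 0 with ht | ht
  · simp only [ps_neg ht]; exact measurable_const
  apply measurable_of_Ioi
  intro c
  have : (fun ω => sSup (partitionSums φ (fun s => b s ω) t)) ⁻¹' Ioi c =
      ⋃ p : ℕ × List ℚ, {ω | (luu t p p.1 = t ∧ ∀ j, j < p.1 → luu t p j < luu t p (j + 1)) ∧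
        c < ∑ j ∈ Finset.range p.1, φ (b (luu t p (j + 1)) ω - b (luu t p j) ω)} := by
    ext ω
    simp only [mem_preimage, mem_Ioi, mem_iUnion, mem_ofPred_eq]
    constructor
    · intro h
      obtain ⟨S, ⟨n, u, h0, hn, hu, rfl⟩, hcS⟩ := exists_lt_of_lt_csSup (ps_nonempty ht) h
      let p : ℕ → ℕ × List ℚ := fun k =>
        (n, (List.range n).map fun j => dgrid k ⌈((k : ℝ) + 1) * u j⌉)
      have hp : ∀ k j, luu t (p k) j = if j = 0 then 0 else if j < n then
          ((dgrid k ⌈((k : ℝ) + 1) * u j⌉ : ℚ) : ℝ) else t := by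
        intro k j
        simp only [luu, p]
        by_cases hj : j = 0
        · simp [hj]
        by_cases hj' : j < n
        · simp [hj, hj', List.getD]
        · simp [hj, hj']
      have hlim : ∀ j ≤ n, Tendsto (fun k => luu t (p k) j) atTop (𝓝 (u j)) ∧
          Tendsto (fun k => b (luu t (p k) j) ω) atTop (𝓝 (b (u j) ω)) := by
        intro j hj
        simp only [hp]
        by_cases hj0 : j = 0
        · subst hj0
          simp only [if_true, h0]; exact ⟨tendsto_const_nhds, tendsto_const_nhds⟩
        by_cases hj' : j < n
        · simp only [hj0, hj', if_true, if_false]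
          exact ⟨(dgrid_tendsto _).mono_right nhdsWithin_le_nhds,
            (hl ω (u j)).comp (dgrid_tendsto _)⟩
        · have : j = n := by omega
          subst this
          simp only [hj0, hj', if_false, hn]; exact ⟨tendsto_const_nhds, tendsto_const_nhds⟩
      have e1 : ∀ᶠ k in atTop, ∀ j ∈ Finset.range n, luu t (p k) j < luu t (p k) (j + 1) := by
        rw [Filter.eventually_all_finset]
        intro j hj
        have hj := Finset.mem_range.1 hj
        exact (hlim j hj.le).1.eventually_lt (hlim (j + 1) hj).1 (hu j hj)
      have e2 : Tendsto (fun k => ∑ j ∈ Finset.range n,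
          φ (b (luu t (p k) (j + 1)) ω - b (luu t (p k) j) ω)) atTop
          (𝓝 (∑ j ∈ Finset.range n, φ (b (u (j + 1)) ω - b (u j) ω))) := by
        apply tendsto_finsetSum
        intro j hj
        have hj := Finset.mem_range.1 hj
        exact (hc.tendsto _).comp ((hlim (j + 1) hj).2.sub (hlim j hj.le).2)
      obtain ⟨k, h1, h2⟩ := (e1.and (e2.eventually (lt_mem_nhds hcS))).exists
      refine ⟨p k, ⟨?_, fun j hj => h1 j (Finset.mem_range.2 hj)⟩, h2⟩
      rw [hp]
      change (if n = 0 then (0:ℝ) else if n < n then _ else t) = t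
      by_cases hn0 : n = 0
      · subst hn0; simp [← hn, h0]
      · simp [hn0]
    · rintro ⟨p, ⟨h1, h2⟩, h3⟩
      exact h3.trans_le (le_csSup (hb ω t) ⟨p.1, luu t p, by simp [luu], h1, h2, rfl⟩)
  rw [this]
  refine MeasurableSet.iUnion fun p => ?_
  by_cases hv : luu t p p.1 = t ∧ ∀ j, j < p.1 → luu t p j < luu t p (j + 1)
  · have hm : Measurable fun ω => ∑ j ∈ Finset.range p.1,
        φ (b (luu t p (j + 1)) ω - b (luu t p j) ω) :=
      Finset.measurable_sum _ fun j _ =>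
        hc.measurable.comp ((hbm (luu t p (j + 1))).sub (hbm (luu t p j)))
    convert hm (measurableSet_Ioi (a := c)) using 1
    ext ω
    exact ⟨fun h => h.2, fun h => ⟨hv, h⟩⟩
  · convert MeasurableSet.empty using 1
    ext ω
    exact ⟨fun h => hv h.1, fun h => h.elim⟩

def clampL (L : ℝ≥0∞) (t : ℝ) : ℝ := if L = ∞ then max 0 t else max 0 (min t L.toReal)

lemma clampL_mem (L : ℝ≥0∞) (t : ℝ) : clampL L t ∈ II L := by
  unfold clampL II
  split_ifs with h
  · simp [h]
  · refine ⟨le_max_left _ _, ?_⟩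
    rw [ENNReal.ofReal_le_iff_le_toReal h]
    exact max_le ENNReal.toReal_nonneg (min_le_right _ _)

lemma clampL_eq {L : ℝ≥0∞} {t : ℝ} (ht : t ∈ II L) : clampL L t = t := by
  unfold clampL
  split_ifs with h
  · exact max_eq_right ht.1
  · have := (ENNReal.ofReal_le_iff_le_toReal h).1 ht.2
    rw [min_eq_left this, max_eq_right ht.1]

lemma clampL_mono (L : ℝ≥0∞) : Monotone (clampL L) := by
  intro s t hst
  unfold clampL
  split_ifs with h
  · exact max_le_max le_rfl hst
  · exact max_le_max le_rfl (min_le_min hst le_rfl)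

lemma bv_decomp {L : ℝ≥0∞} {v : ℝ → ℝ} (h : IsBV L v) :
    ∃ A B : ℝ → ℝ, ∃ K : ℝ, Monotone A ∧ Monotone B ∧ (∀ t, |A t| ≤ K) ∧ (∀ t, |B t| ≤ K) ∧
      ∀ t, v (clampL L t) = A t - B t := by
  obtain ⟨M, hM⟩ := h
  have hM1 : ∀ t ∈ II L, ∀ S ∈ partitionSums (fun x => max x 0) v t, S ≤ M := by
    intro t ht S hS
    obtain ⟨S', hS'⟩ := ps_nonempty (φ := fun x => max (-x) 0) (v := v) ht.1
    have := hM t ht S hS S' hS'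
    have := ps_nonneg (fun x => le_max_right _ _) hS'
    linarith
  have hbd : ∀ t ∈ II L, BddAbove (partitionSums (fun x => max x 0) v t) :=
    fun t ht => ⟨M, fun S hS => hM1 t ht S hS⟩
  have h0 : ∀ t ∈ II L, 0 ≤ posVar v t := fun t ht =>
    Real.sSup_nonneg fun S hS => ps_nonneg (fun x => le_max_right _ _) hS
  have h1 : ∀ t ∈ II L, posVar v t ≤ M := fun t ht =>
    csSup_le (ps_nonempty ht.1) (hM1 t ht)
  have hM0 : 0 ≤ M := (h0 _ (clampL_mem L 0)).trans (h1 _ (clampL_mem L 0))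
  have h2 : ∀ t ∈ II L, |v t - v 0| ≤ M := by
    intro t ht
    rcases ht.1.eq_or_lt with rfl | htp
    · simpa using hM0
    · have := hM t ht _ (ps_single htp) _ (ps_single htp)
      refine le_trans ?_ this
      rw [abs_le]
      constructor
      · linarith [le_max_left (-(v t - v 0)) 0, le_max_right (v t - v 0) 0]
      · linarith [le_max_right (-(v t - v 0)) 0, le_max_left (v t - v 0) 0]
  refine ⟨fun t => posVar v (clampL L t), fun t => posVar v (clampL L t) - v (clampL L t),
    M + M + |v 0|, ?_, ?_, ?_, ?_, ?_⟩
  · intro s t hst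
    exact W_mono (fun x => le_max_right _ _) (clampL_mem L s).1 (clampL_mono L hst)
      (hbd _ (clampL_mem L t))
  · intro s t hst
    rcases (clampL_mono L hst).eq_or_lt with h | h
    · simp only [h]; exact le_rfl
    · have := W_incr (φ := fun x => max x 0) (clampL_mem L s).1 h (hbd _ (clampL_mem L t))
      have h3 := le_max_left (v (clampL L t) - v (clampL L s)) 0
      simp only [posVar] at this ⊢
      linarith
  · intro t
    have := h0 _ (clampL_mem L t)
    have := h1 _ (clampL_mem L t)
    have := abs_nonneg (v 0)
    rw [abs_le]; constructor <;> linarith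
  · intro t
    have := h0 _ (clampL_mem L t)
    have := h1 _ (clampL_mem L t)
    have h4 := abs_le.1 (h2 _ (clampL_mem L t))
    have := neg_abs_le (v 0)
    have := le_abs_self (v 0)
    rw [abs_le]; constructor <;> linarith [h4.1, h4.2]
  · intro t; ring

lemma ps_bound {φ v C : ℝ → ℝ} (hC : ∀ s t, s ≤ t → φ (v t - v s) ≤ C t - C s)
    {t S : ℝ} (h : S ∈ partitionSums φ v t) : S ≤ C t - C 0 := by
  obtain ⟨n, u, h0, hn, hu, rfl⟩ := h
  calc _ ≤ ∑ j ∈ Finset.range n, (C (u (j + 1)) - C (u j)) :=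
        Finset.sum_le_sum fun j hj => hC _ _ (hu j (Finset.mem_range.1 hj)).le
    _ = C (u n) - C (u 0) := Finset.sum_range_sub (fun j => C (u j)) n
    _ = _ := by rw [h0, hn]

lemma borel_le_lebSA : (inferInstance : MeasurableSpace ℝ) ≤ lebSA :=
  fun s hs => hs.nullMeasurableSet (μ := volume)

lemma meas_leb {Ω : Type*} [mΩ : MeasurableSpace Ω] {f : ℝ × Ω → ℝ} (h : Measurable f) :
    @Measurable (ℝ × Ω) ℝ (lebSA.prod mΩ) _ f := by
  refine h.mono ?_ le_rfl
  exact sup_le_sup (MeasurableSpace.comap_mono borel_le_lebSA) le_rfl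

lemma leb_aemeas {Ω : Type*} [mΩ : MeasurableSpace Ω] (P : Measure Ω) [IsProbabilityMeasure P]
    (I : Set ℝ) {f : ℝ × Ω → ℝ} (h : @Measurable (ℝ × Ω) ℝ (lebSA.prod mΩ) _ f) :
    AEMeasurable f ((volume.restrict I).prod P) := by
  have hle : ∀ s, @MeasurableSet _ (lebSA.prod mΩ) s →
      NullMeasurableSet s ((volume.restrict I).prod P) := by
    have : lebSA.prod mΩ ≤ (inferInstance : MeasurableSpace
        (NullMeasurableSpace (ℝ × Ω) ((volume.restrict I).prod P))) := by
      refine sup_le ?_ ?_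
      · rintro s ⟨s', hs', rfl⟩
        have h1 : NullMeasurableSet s' (volume : Measure ℝ) := hs'
        have h2 : NullMeasurableSet s' (volume.restrict I : Measure ℝ) :=
          h1.mono_ac Measure.restrict_le_self.absolutelyContinuous
        exact h2.preimage Measure.quasiMeasurePreserving_fst
      · rintro s ⟨s', hs', rfl⟩
        exact (measurable_snd hs').nullMeasurableSet
    exact this
  have : NullMeasurable f ((volume.restrict I).prod P) := fun s hs => hle _ (h hs)
  exact this.aemeasurable

/-- A jointly measurable process (w.r.t. `𝓛([0,L]) ⊗ ℱ`) whose paths are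
almost surely of bounded variation on `[0,L]` has a jointly measurable version `b = a`
`λ⊗P`-a.e. all of whose paths are left-continuous and of bounded variation, and whose
positive and negative variation processes `b₊`, `b₋` are jointly measurable with all paths
left-continuous and nondecreasing. -/
theorem stmt2 {Ω : Type*} [mΩ : MeasurableSpace Ω] (P : Measure Ω) [IsProbabilityMeasure P]
    (L : ℝ≥0∞) (hL : 0 < L) (a : ℝ → Ω → ℝ)
    (hmeas : @Measurable (ℝ × Ω) ℝ (lebSA.prod mΩ) _ fun p => a p.1 p.2)
    (hbv : ∀ᵐ ω ∂P, IsBV L fun t => a t ω) :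
    ∃ b : ℝ → Ω → ℝ,
      (@Measurable (ℝ × Ω) ℝ (lebSA.prod mΩ) _ fun p => b p.1 p.2) ∧
      (∀ᵐ p ∂((volume.restrict (II L)).prod P), b p.1 p.2 = a p.1 p.2) ∧
      (∀ ω : Ω, LeftCts L (fun t => b t ω) ∧ IsBV L fun t => b t ω) ∧
      (@Measurable (ℝ × Ω) ℝ (lebSA.prod mΩ) _ fun p => posVar (fun s => b s p.2) p.1) ∧
      (@Measurable (ℝ × Ω) ℝ (lebSA.prod mΩ) _ fun p => negVar (fun s => b s p.2) p.1) ∧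
      (∀ ω : Ω, LeftCts L (fun t => posVar (fun s => b s ω) t) ∧
                MonotoneOn (fun t => posVar (fun s => b s ω) t) (II L) ∧
                LeftCts L (fun t => negVar (fun s => b s ω) t) ∧
                MonotoneOn (fun t => negVar (fun s => b s ω) t) (II L)) := by
  -- good set
  obtain ⟨G, hGs, hGm, hG⟩ : ∃ G : Set Ω, (∀ ω ∈ G, IsBV L fun t => a t ω) ∧
      MeasurableSet G ∧ ∀ᵐ ω ∂P, ω ∈ G := by
    obtain ⟨T, h1, h2, h3⟩ := exists_measurable_superset_of_null (ae_iff.1 hbv)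
    refine ⟨Tᶜ, fun ω hω => ?_, h2.compl, ?_⟩
    · by_contra hn; exact hω (h1 hn)
    · rw [ae_iff]; simpa using h3
  classical
  let f : ℝ → Ω → ℝ := fun t ω => if ω ∈ G then a (clampL L t) ω else 0
  have hsec : ∀ s, Measurable (a s) := by
    intro s
    have : @Measurable Ω (ℝ × Ω) mΩ (lebSA.prod mΩ) (fun ω => (s, ω)) :=
      @measurable_prodMk_left ℝ Ω lebSA mΩ s
    exact hmeas.comp this
  have hf : ∀ s, Measurable (f s) := fun s => Measurable.ite hGm (hsec _) measurable_const
  have hdec : ∀ ω, ∃ A B : ℝ → ℝ, ∃ K : ℝ, Monotone A ∧ Monotone B ∧ (∀ t, |A t| ≤ K) ∧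
      (∀ t, |B t| ≤ K) ∧ ∀ t, f t ω = A t - B t := by
    intro ω
    by_cases hω : ω ∈ G
    · simpa [f, hω] using bv_decomp (hGs ω hω)
    · exact ⟨fun _ => 0, fun _ => 0, 0, monotone_const, monotone_const, by simp, by simp,
        by simp [f, hω]⟩
  choose A B K hA hB hAK hBK hfAB using hdec
  let A' : Ω → ℝ → ℝ := fun ω => Function.leftLim (A ω)
  let B' : Ω → ℝ → ℝ := fun ω => Function.leftLim (B ω)
  have hA' : ∀ ω, Monotone (A' ω) := fun ω => (hA ω).leftLim
  have hB' : ∀ ω, Monotone (B' ω) := fun ω => (hB ω).leftLim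
  have bdl : ∀ (C : ℝ → ℝ) (k : ℝ), Monotone C → (∀ t, |C t| ≤ k) →
      ∀ t, |Function.leftLim C t| ≤ k := by
    intro C k hC hk t
    rw [abs_le]
    exact ⟨(abs_le.1 (hk (t - 1))).1.trans (hC.le_leftLim (by linarith)),
      (hC.leftLim_le le_rfl).trans (abs_le.1 (hk t)).2⟩
  have hAK' : ∀ ω t, |A' ω t| ≤ K ω := fun ω => bdl _ _ (hA ω) (hAK ω)
  have hBK' : ∀ ω t, |B' ω t| ≤ K ω := fun ω => bdl _ _ (hB ω) (hBK ω)
  have lcl : ∀ (C : ℝ → ℝ), Monotone C → ∀ t,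
      Tendsto (Function.leftLim C) (𝓝[<] t) (𝓝 (Function.leftLim C t)) := by
    intro C hC t
    have := _root_.continuousWithinAt_leftLim_Iic (hC.tendsto_leftLim t)
    exact this.mono_left (nhdsWithin_mono _ Iio_subset_Iic_self)
  let b : ℝ → Ω → ℝ := fun t ω => A' ω t - B' ω t
  have hfb : ∀ t ω, Tendsto (fun s => f s ω) (𝓝[<] t) (𝓝 (b t ω)) := by
    intro t ω
    simp only [hfAB]
    exact ((hA ω).tendsto_leftLim t).sub ((hB ω).tendsto_leftLim t)
  have hbB : Measurable fun p : ℝ × Ω => b p.1 p.2 := joint_meas hf hfb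
  have hbs : ∀ s, Measurable (b s) := fun s => hbB.comp measurable_prodMk_left
  have hbl : ∀ ω t, Tendsto (fun s => b s ω) (𝓝[<] t) (𝓝 (b t ω)) := fun ω t =>
    (lcl _ (hA ω) t).sub (lcl _ (hB ω) t)
  have hpb : ∀ ω t, ∀ S ∈ partitionSums (fun x => max x 0) (fun s => b s ω) t,
      S ≤ K ω + K ω := by
    intro ω t S hS
    have h := ps_bound (C := A' ω) (by
      intro s t hst
      have h1 := hA' ω hst
      have h2 := hB' ω hst
      simp only [b]
      exact max_le (by linarith) (by linarith)) hS
    linarith [(abs_le.1 (hAK' ω t)).2, (abs_le.1 (hAK' ω 0)).1]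
  have hnb : ∀ ω t, ∀ S ∈ partitionSums (fun x => max (-x) 0) (fun s => b s ω) t,
      S ≤ K ω + K ω := by
    intro ω t S hS
    have h := ps_bound (C := B' ω) (by
      intro s t hst
      have h1 := hA' ω hst
      have h2 := hB' ω hst
      simp only [b]
      exact max_le (by linarith) (by linarith)) hS
    linarith [(abs_le.1 (hBK' ω t)).2, (abs_le.1 (hBK' ω 0)).1]
  have hpbd : ∀ ω t, BddAbove (partitionSums (fun x => max x 0) (fun s => b s ω) t) :=
    fun ω t => ⟨_, fun S hS => hpb ω t S hS⟩
  have hnbd : ∀ ω t, BddAbove (partitionSums (fun x => max (-x) 0) (fun s => b s ω) t) :=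
    fun ω t => ⟨_, fun S hS => hnb ω t S hS⟩
  have cp : Continuous fun x : ℝ => max x 0 := by fun_prop
  have cn : Continuous fun x : ℝ => max (-x) 0 := by fun_prop
  have pl : ∀ ω t, Tendsto (fun s => posVar (fun r => b r ω) s) (𝓝[<] t)
      (𝓝 (posVar (fun r => b r ω) t)) := fun ω t =>
    W_left (fun x => le_max_right _ _) cp (hpbd ω) (hbl ω) t
  have nl : ∀ ω t, Tendsto (fun s => negVar (fun r => b r ω) s) (𝓝[<] t)
      (𝓝 (negVar (fun r => b r ω) t)) := fun ω t =>
    W_left (fun x => le_max_right _ _) cn (hnbd ω) (hbl ω) t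
  refine ⟨b, meas_leb hbB, ?_, ?_, ?_, ?_, ?_⟩
  · have ham := leb_aemeas P (II L) hmeas
    have h1 := ham.ae_eq_mk
    have h2 : ∀ᵐ ω ∂P, ∀ᵐ t ∂(volume.restrict (II L)), a t ω = ham.mk _ (t, ω) := by
      have h3 := (Measure.measurePreserving_swap (μ := P)
        (ν := volume.restrict (II L))).quasiMeasurePreserving.ae h1
      exact Measure.ae_ae_of_ae_prod h3
    have hI : MeasurableSet (II L) := by
      have : II L = Ici 0 ∩ ENNReal.ofReal ⁻¹' Iic L := rfl
      rw [this]
      exact measurableSet_Ici.inter (ENNReal.measurable_ofReal measurableSet_Iic)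
    have h4 : ∀ᵐ ω ∂P, ∀ᵐ t ∂(volume.restrict (II L)), b t ω = ham.mk _ (t, ω) := by
      filter_upwards [h2, hG] with ω hω hωG
      have c1 := (hA ω).countable_not_continuousAt.ae_notMem (volume.restrict (II L))
      have c2 := (hB ω).countable_not_continuousAt.ae_notMem (volume.restrict (II L))
      filter_upwards [hω, c1, c2, ae_restrict_mem hI] with t e1 e2 e3 e4
      rw [← e1]
      simp only [mem_ofPred_eq, not_not] at e2 e3
      have e5 : f t ω = a t ω := by simp [f, hωG, clampL_eq e4]
      rw [← e5, hfAB]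
      simp only [b, A', B']
      rw [(hA ω).continuousWithinAt_Iio_iff_leftLim_eq.1 e2.continuousWithinAt,
        (hB ω).continuousWithinAt_Iio_iff_leftLim_eq.1 e3.continuousWithinAt]
    have hms : MeasurableSet {p : ℝ × Ω | b p.1 p.2 = ham.mk _ (p.1, p.2)} :=
      measurableSet_eq_fun hbB ham.measurable_mk
    have h5 := (Measure.ae_prod_iff_ae_ae hms).2 ((Measure.ae_ae_comm hms).2 h4)
    filter_upwards [h5, h1] with p e1 e2
    rw [e1, e2]
  · intro ω
    exact ⟨fun t _ _ => hbl ω t, K ω + K ω + (K ω + K ω), fun t _ Sp hp Sn hn =>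
      add_le_add (hpb ω t Sp hp) (hnb ω t Sn hn)⟩
  · exact meas_leb (joint_meas (fun s => W_meas cp hbs hbl hpbd s) fun t ω => pl ω t)
  · exact meas_leb (joint_meas (fun s => W_meas cn hbs hbl hnbd s) fun t ω => nl ω t)
  · intro ω
    exact ⟨fun t _ _ => pl ω t,
      fun s hs t _ hst => W_mono (fun x => le_max_right _ _) hs.1 hst (hpbd ω t),
      fun t _ _ => nl ω t,
      fun s hs t _ hst => W_mono (fun x => le_max_right _ _) hs.1 hst (hnbd ω t)⟩
end
end

section
/- Let (Ω,ℱ,P) be a probability space, L ∈ (0,∞], and let X : [0,L]×Ω → ℝ be 𝓛([0,L])⊗ℱ-measurable such that for P-almost every ω the path s ↦ X(s,ω) is left-continuous on [0,L]. Define c : [0,L)×Ω → [−∞,∞] by c(t,ω) = limsup_{s↘t} (X(s,ω) − X(t,ω))/ψ(s−t). Then c coincides λ⊗P-almost everywhere with an 𝓛([0,L))⊗ℱ-measurable function (equivalently, c is measurable with respect to the λ⊗P-completion of 𝓛([0,L))⊗ℱ). -/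
open MeasureTheory Filter Set
open scoped Topology ENNReal

noncomputable section

/-- `ψ(h) = √(2h · log log(1/h))`. -/
def psi (h : ℝ) : ℝ := Real.sqrt (2 * h * Real.log (Real.log (1 / h)))

/-- The filter of `s → t⁺` along `s ∈ (t, t + e⁻¹) ∩ [0,L]`. -/
def rfil (L : ℝ≥0∞) (t : ℝ) : Filter ℝ := 𝓝[Set.Ioo t (t + Real.exp (-1)) ∩ II L] t

lemma psi_pos' {h : ℝ} (h0 : 0 < h) (h1 : h < Real.exp (-1)) :
    psi h ≠ 0 ∧ ContinuousAt psi h := by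
  have hl : 1 < Real.log (1 / h) := by
    have : Real.log h < -1 := (Real.log_lt_iff_lt_exp h0).2 h1
    rw [one_div, Real.log_inv]; linarith
  have hll : 0 < Real.log (Real.log (1 / h)) := Real.log_pos hl
  refine ⟨(Real.sqrt_pos.2 (by positivity)).ne', ?_⟩
  have hc1 : ContinuousAt (fun h : ℝ => 1 / h) h := continuousAt_const.div continuousAt_id h0.ne'
  have hc2 : ContinuousAt (fun h : ℝ => Real.log (1 / h)) h := hc1.log (one_div_pos.2 h0).ne'
  have hc3 : ContinuousAt (fun h : ℝ => Real.log (Real.log (1 / h))) h :=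
    hc2.log (by linarith)
  exact ((continuousAt_const.mul continuousAt_id).mul hc3).sqrt

lemma psi_meas : Measurable psi := by
  unfold psi
  fun_prop

def gg {α Ω : Type*} (τ : α → ℝ) (e : ℝ → α) (X : α → Ω → ℝ) (p : α × Ω) : EReal :=
  ⨅ n : ℕ, ⨆ q : ℚ, if τ p.1 < q ∧ (q : ℝ) < τ p.1 + 1 / ((n : ℝ) + 1) then
    (((X (e q) p.2 - X p.1 p.2) / psi (q - τ p.1) : ℝ) : EReal) else ⊥

lemma gg_meas {α Ω : Type*} [MeasurableSpace α] [MeasurableSpace Ω] (τ : α → ℝ)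
    (hτ : Measurable τ) (e : ℝ → α) (X : α → Ω → ℝ)
    (hX : Measurable (fun p : α × Ω => X p.1 p.2)) : Measurable (gg τ e X) := by
  unfold gg
  refine Measurable.iInf fun n => Measurable.iSup fun q => ?_
  have h1 : Measurable (fun p : α × Ω => τ p.1) := hτ.comp measurable_fst
  have h2 : Measurable (fun p : α × Ω => X (e q) p.2) :=
    hX.comp (measurable_const.prodMk measurable_snd)
  refine Measurable.ite ?_ ?_ measurable_const
  · exact (measurableSet_lt h1 measurable_const).inter
      (measurableSet_lt measurable_const (h1.add_const _))
  · exact measurable_coe_real_ereal.comp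
      ((h2.sub hX).div (psi_meas.comp (measurable_const.sub h1)))

lemma rfil_eq {L : ℝ≥0∞} {t : ℝ} (ht : t ∈ IIco L) :
    ∃ r > t, (∀ s ∈ Ioo t r, s ∈ II L ∧ s < t + Real.exp (-1)) ∧ rfil L t = 𝓝[>] t := by
  obtain ⟨h0, h1⟩ := ht
  have hev : ∀ᶠ s in 𝓝[>] t, s ∈ Ioo t (t + Real.exp (-1)) ∩ II L := by
    have e1 : ∀ᶠ s in 𝓝[>] t, ENNReal.ofReal s < L :=
      (ENNReal.continuous_ofReal.continuousAt.eventually_lt continuousAt_const h1).filter_mono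
        nhdsWithin_le_nhds
    have e2 : Ioo t (t + Real.exp (-1)) ∈ 𝓝[>] t :=
      Ioo_mem_nhdsGT (by linarith [Real.exp_pos (-1)])
    filter_upwards [e1, e2] with s hs1 hs2
    exact ⟨hs2, (h0.trans hs2.1.le), hs1.le⟩
  obtain ⟨r, hr, hsub⟩ := (mem_nhdsGT_iff_exists_Ioo_subset).1 hev
  refine ⟨r, hr, fun s hs => ⟨(hsub hs).2, (hsub hs).1.2⟩, le_antisymm ?_ ?_⟩
  · exact nhdsWithin_mono _ fun s hs => hs.1.1
  · exact le_inf nhdsWithin_le_nhds (le_principal_iff.2 hev)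

lemma limsup_eq_gg {Ω : Type*} {L : ℝ≥0∞} {t : ℝ} (ht : t ∈ IIco L) (X : ℝ → Ω → ℝ) (ω : Ω)
    (hl : LeftCts L fun t => X t ω) :
    Filter.limsup (fun s => (((X s ω - X t ω) / psi (s - t) : ℝ) : EReal)) (rfil L t)
      = gg id id X (t, ω) := by
  obtain ⟨r, hr, hsub, hf⟩ := rfil_eq ht
  rw [hf]
  have hpos : ∀ n : ℕ, t < t + 1 / ((n : ℝ) + 1) := fun n => by
    have : 0 < 1 / ((n : ℝ) + 1) := by positivity
    linarith
  refine le_antisymm ?_ ?_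
  · refine le_iInf fun n => ?_
    refine limsup_le_of_le (by isBoundedDefault) ?_
    filter_upwards [Ioo_mem_nhdsGT hr, Ioo_mem_nhdsGT (hpos n)] with s hs1 hs2
    obtain ⟨hsL, hse⟩ := hsub s hs1
    have hs0 : 0 < s := lt_of_le_of_lt ht.1 hs1.1
    obtain ⟨hp0, hpc⟩ := psi_pos' (h := s - t) (by linarith [hs1.1]) (by linarith)
    have hpt : Tendsto (fun s => psi (s - t)) (𝓝[<] s) (𝓝 (psi (s - t))) := by
      have : ContinuousAt (fun s => psi (s - t)) s :=
        ContinuousAt.comp (f := fun s => s - t) hpc (by fun_prop)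
      exact this.tendsto.mono_left nhdsWithin_le_nhds
    have hlim : Tendsto (fun s => (((X s ω - X t ω) / psi (s - t) : ℝ) : EReal)) (𝓝[<] s)
        (𝓝 (((X s ω - X t ω) / psi (s - t) : ℝ) : EReal)) :=
      (continuous_coe_real_ereal.tendsto _).comp
        (((hl s hsL hs0).sub_const _).div hpt hp0)
    refine le_of_tendsto_of_frequently hlim ?_
    rw [frequently_iff]
    intro U hU
    obtain ⟨a, ha, haU⟩ := (mem_nhdsLT_iff_exists_Ioo_subset).1 hU
    obtain ⟨q, hq1, hq2⟩ := exists_rat_btwn (max_lt ha hs1.1)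
    refine ⟨q, haU ⟨(le_max_left _ _).trans_lt hq1, hq2⟩, ?_⟩
    refine le_trans (le_of_eq ?_) (le_iSup _ q)
    rw [if_pos ⟨(le_max_right _ _).trans_lt hq1, hq2.trans hs2.2⟩]
    rfl
  · have hb := (nhdsGT_basis t).limsup_eq_iInf_iSup
      (u := fun s => (((X s ω - X t ω) / psi (s - t) : ℝ) : EReal))
    rw [hb]
    refine le_iInf₂ fun b hb => ?_
    obtain ⟨n, hn⟩ := exists_nat_one_div_lt (sub_pos.2 hb)
    refine (iInf_le _ n).trans (iSup_le fun q => ?_)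
    split_ifs with h
    · have hq : (q : ℝ) ∈ Ioo t b := ⟨h.1, by have := h.2; simp only [id] at this; linarith⟩
      exact le_iSup₂ (f := fun (s : ℝ) (_ : s ∈ Ioo t b) =>
        (((X s ω - X t ω) / psi (s - t) : ℝ) : EReal)) (q : ℝ) hq
    · exact bot_le

/-- Let `X` be jointly measurable w.r.t. `𝓛([0,L]) ⊗ ℱ` with `P`-a.s.
left-continuous paths. Then `c(t,ω) = limsup_{s↘t} (X(s,ω) - X(t,ω))/ψ(s-t)` (the limsup
taken along `s ∈ (t, t+e⁻¹) ∩ [0,L]`), as a map `[0,L) × Ω → [-∞,∞]`, coincides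
`λ⊗P`-a.e. with a `𝓛 ⊗ ℱ`-measurable function. -/
theorem stmt7 {Ω : Type*} [mΩ : MeasurableSpace Ω] (P : Measure Ω) [IsProbabilityMeasure P]
    (L : ℝ≥0∞) (hL : 0 < L) (X : ℝ → Ω → ℝ)
    (hmeas : @Measurable (ℝ × Ω) ℝ (lebSA.prod mΩ) _ fun p => X p.1 p.2)
    (hlc : ∀ᵐ ω ∂P, LeftCts L fun t => X t ω) :
    ∃ g : ℝ × Ω → EReal,
      (@Measurable (ℝ × Ω) EReal (lebSA.prod mΩ) _ g) ∧
      ∀ᵐ p ∂((volume.restrict (IIco L)).prod P),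
        Filter.limsup
          (fun s => (((X s p.2 - X p.1 p.2) / psi (s - p.1) : ℝ) : EReal)) (rfil L p.1)
          = g p := by
  refine ⟨gg id id X, ?_, ?_⟩
  · refine @gg_meas ℝ Ω lebSA mΩ id ?_ id X hmeas
    intro s hs
    exact MeasurableSet.nullMeasurableSet hs
  · have hI : MeasurableSet (IIco L) :=
      measurableSet_Ici.inter (measurableSet_lt ENNReal.measurable_ofReal measurable_const)
    have h1 : ∀ᵐ p ∂((volume.restrict (IIco L)).prod P), p.1 ∈ IIco L :=
      Measure.quasiMeasurePreserving_fst.ae (ae_restrict_mem hI)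
    have h2 : ∀ᵐ p ∂((volume.restrict (IIco L)).prod P), LeftCts L fun t => X t p.2 :=
      Measure.quasiMeasurePreserving_snd.ae hlc
    filter_upwards [h1, h2] with p hp1 hp2
    exact limsup_eq_gg hp1 X p.2 hp2
end
end
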